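/- arXiv:1503.06315 — 3 statements merged into one kernel-verified Lean document; each statement's English description precedes it below -/
import Mathlib

section
/- Let s > 1 and suppose Z_s := sup_{k≥0} |z_k| (m+k)^s < ∞. Then for every k ≥ 0 the series defining x_k converges absolutely and |x_k| ≤ Z_s / ( C₁ γ (1−θ) (k+1)^{s_L} (m+k)^s ); in particular sup_{k≥0} |x_k| (m+k)^{s+s_L} < ∞, i.e. U⁻¹ maps Ω^s into Ω^{s+s_L}. -/
/-- The general term (index `l`) of the series defining `x = U⁻¹ z`:
`(−1)^l (δ_k/δ_{k+l+1}) c_{k+1}⋯c_{k+l} z_{k+l}`. -/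
noncomputable def Uterm (c d z : ℕ → ℝ) (k l : ℕ) : ℝ :=
  (-1 : ℝ) ^ l * (d k / d (k + l + 1)) * (∏ i ∈ Finset.range l, c (k + 1 + i)) * z (k + l)

/-- `x = U⁻¹ z` : `x_k = (δ_k/δ_{k+1}) z_k + Σ_{l=1}^{∞} (−1)^l (δ_k/δ_{k+l+1})
c_{k+1}⋯c_{k+l} z_{k+l}`. -/
noncomputable def Uinv (c d z : ℕ → ℝ) (k : ℕ) : ℝ :=
  d k / d (k + 1) * z k + ∑' l : ℕ, Uterm c d z k (l + 1)

/-- A root `γ ∈ (0, 1]` of `x = 1 - δ² / x` is a lower bound for the growth ratio of `d`. -/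
theorem mul_abs_le_abs_succ {δ γ : ℝ} (hδ0 : 0 ≤ δ) (hγ0 : 0 < γ) (hγ1 : γ ≤ 1)
    (hfix : γ * γ + δ ^ 2 = γ) {a b c d : ℕ → ℝ}
    (ha : ∀ n, 2 ≤ n → |a n| ≤ δ * |b n|) (hc : ∀ n, 1 ≤ n → |c n| ≤ δ * |b n|)
    (hd0 : d 0 = 1) (hd1 : d 1 = b 1)
    (hd : ∀ n : ℕ, d (n + 2) = b (n + 2) * d (n + 1) - a (n + 2) * c (n + 1) * d n) (n : ℕ) :
    γ * |b (n + 1)| * |d n| ≤ |d (n + 1)| := by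
  induction n with
  | zero =>
    simp only [zero_add, hd0, hd1, abs_one, mul_one]
    exact mul_le_of_le_one_left (abs_nonneg _) hγ1
  | succ n ih =>
    have hac : |a (n + 2) * c (n + 1)| ≤ (δ * |b (n + 2)|) * (δ * |b (n + 1)|) := by
      rw [abs_mul]
      exact mul_le_mul (ha _ (by omega)) (hc _ (by omega)) (abs_nonneg _) (by positivity)
    have htri : |b (n + 2)| * |d (n + 1)| - |a (n + 2) * c (n + 1)| * |d n| ≤ |d (n + 2)| := by
      rw [hd n, ← abs_mul, ← abs_mul]
      exact abs_sub_abs_le_abs_sub _ _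
    have hlow := mul_le_mul_of_nonneg_right hac (abs_nonneg (d n))
    have hih := mul_le_mul_of_nonneg_left ih (by positivity : 0 ≤ δ ^ 2 * |b (n + 2)|)
    have hstep := mul_le_mul_of_nonneg_left (htri.trans' (sub_le_sub_left hlow _)) hγ0.le
    refine le_of_mul_le_mul_left ?_ hγ0
    show γ * (γ * |b (n + 2)| * |d (n + 1)|) ≤ γ * |d (n + 2)|
    linear_combination hstep + hih + |b (n + 2)| * |d (n + 1)| * hfix

theorem abs_mul_prod_le_pow_mul_abs {θ : ℝ} (hθ : 0 ≤ θ) {c d : ℕ → ℝ}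
    (h : ∀ n, |c (n + 1)| * |d n| ≤ θ * |d (n + 1)|) (k l : ℕ) :
    |d k| * ∏ i ∈ Finset.range l, |c (k + 1 + i)| ≤ θ ^ l * |d (k + l)| := by
  induction l with
  | zero => simp
  | succ l ih =>
    rw [Finset.prod_range_succ, show k + 1 + l = k + l + 1 by omega]
    calc |d k| * ((∏ i ∈ Finset.range l, |c (k + 1 + i)|) * |c (k + l + 1)|)
        = (|d k| * ∏ i ∈ Finset.range l, |c (k + 1 + i)|) * |c (k + l + 1)| := by ring
      _ ≤ θ ^ l * |d (k + l)| * |c (k + l + 1)| := by gcongr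
      _ = θ ^ l * (|c (k + l + 1)| * |d (k + l)|) := by ring
      _ ≤ θ ^ l * (θ * |d (k + l + 1)|) := mul_le_mul_of_nonneg_left (h _) (pow_nonneg hθ l)
      _ = θ ^ (l + 1) * |d (k + (l + 1))| := by rw [← add_assoc]; ring

theorem Uterm_zero (c d z : ℕ → ℝ) (k : ℕ) : Uterm c d z k 0 = d k / d (k + 1) * z k := by
  simp [Uterm]

theorem abs_Uterm (c d z : ℕ → ℝ) (k l : ℕ) :
    |Uterm c d z k l| =
      (|d k| * ∏ i ∈ Finset.range l, |c (k + 1 + i)|) / |d (k + l + 1)| * |z (k + l)| := by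
  simp only [Uterm, abs_mul, abs_pow, abs_neg, abs_one, one_pow, one_mul, abs_div,
    Finset.abs_prod]
  ring

theorem abs_Uterm_le {θ ε B : ℝ} (hθ : 0 ≤ θ) {c d z : ℕ → ℝ}
    (hcd : ∀ n, |c (n + 1)| * |d n| ≤ θ * |d (n + 1)|) (hd : ∀ n, d n ≠ 0) (hε : 0 ≤ ε) (k l : ℕ)
    (hr : |d (k + l)| / |d (k + l + 1)| ≤ ε) (hz : |z (k + l)| ≤ B) :
    |Uterm c d z k l| ≤ ε * B * θ ^ l := by
  have hpos : 0 < |d (k + l + 1)| := abs_pos.2 (hd _)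
  calc |Uterm c d z k l|
      ≤ (θ ^ l * |d (k + l)|) / |d (k + l + 1)| * |z (k + l)| := by
        rw [abs_Uterm]
        gcongr ?_ / _ * _
        exact abs_mul_prod_le_pow_mul_abs hθ hcd k l
    _ = θ ^ l * (|d (k + l)| / |d (k + l + 1)| * |z (k + l)|) := by ring
    _ ≤ θ ^ l * (ε * B) := by gcongr
    _ = ε * B * θ ^ l := by ring

theorem summable_and_abs_Uinv_le {θ A : ℝ} (hθ0 : 0 ≤ θ) (hθ1 : θ < 1) {c d z : ℕ → ℝ} {k : ℕ}
    (h : ∀ l, |Uterm c d z k l| ≤ A * θ ^ l) :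
    Summable (fun l : ℕ => |Uterm c d z k (l + 1)|) ∧ |Uinv c d z k| ≤ A / (1 - θ) := by
  have hgeom : HasSum (fun l => A * θ ^ l) (A / (1 - θ)) := by
    simpa [div_eq_mul_inv] using (hasSum_geometric_of_lt_one hθ0 hθ1).mul_left A
  have habs : Summable fun l => |Uterm c d z k l| :=
    .of_nonneg_of_le (fun _ => abs_nonneg _) h hgeom.summable
  refine ⟨(summable_nat_add_iff 1).2 habs, ?_⟩
  have hx : Uinv c d z k = ∑' l, Uterm c d z k l := by
    rw [habs.of_abs.tsum_eq_zero_add, Uterm_zero, Uinv]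
  rw [hx]
  exact tsum_of_norm_bounded (f := Uterm c d z k) hgeom h

/-- if `Z_s := sup_{k≥0} |z_k| (m+k)^s < ∞` (`s > 1`), then for every
`k ≥ 0` the series defining `x_k` converges absolutely and
`|x_k| ≤ Z_s / (C₁ γ (1−θ) (k+1)^{s_L} (m+k)^s)`; in particular
`sup_{k≥0} |x_k| (m+k)^{s+s_L} < ∞`, i.e. `U⁻¹` maps `Ω^s` into `Ω^{s+s_L}`. -/
theorem statement6 (δ : ℝ) (hδ0 : 0 < δ) (hδ1 : δ < 1 / 2)
    (a b c : ℕ → ℝ)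
    (hb : ∀ n, 1 ≤ n → b n ≠ 0)
    (ha : ∀ n, 2 ≤ n → |a n| ≤ δ * |b n|)
    (hc : ∀ n, 1 ≤ n → |c n| ≤ δ * |b n|)
    (d : ℕ → ℝ)
    (hd0 : d 0 = 1) (hd1 : d 1 = b 1)
    (hd : ∀ n : ℕ, d (n + 2) = b (n + 2) * d (n + 1) - a (n + 2) * c (n + 1) * d n)
    (γ θ : ℝ) (hγ : γ = 1 / 2 + Real.sqrt (1 / 4 - δ ^ 2)) (hθ : θ = δ / γ)
    (m : ℕ) (hm : 1 ≤ m) (sL C₁ : ℝ) (hsL : 0 < sL) (hC₁ : 0 < C₁)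
    (hblow : ∀ k : ℕ, C₁ * ((m : ℝ) + k) ^ sL ≤ |b (k + 1)|)
    (z : ℕ → ℝ) (s : ℝ) (hs : 1 < s)
    (hz : BddAbove (Set.range fun k => |z k| * ((m : ℝ) + k) ^ s)) :
    (∀ k : ℕ, Summable (fun l : ℕ => |Uterm c d z k (l + 1)|) ∧
      |Uinv c d z k| ≤ (⨆ j : ℕ, |z j| * ((m : ℝ) + j) ^ s) /
        (C₁ * γ * (1 - θ) * ((k : ℝ) + 1) ^ sL * ((m : ℝ) + k) ^ s)) ∧
    BddAbove (Set.range fun k => |Uinv c d z k| * ((m : ℝ) + k) ^ (s + sL)) := by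
  have hrad : 0 < 1 / 4 - δ ^ 2 := by nlinarith
  have hsq := Real.mul_self_sqrt hrad.le
  have hroot : 0 < √(1 / 4 - δ ^ 2) := Real.sqrt_pos.2 hrad
  have hroot_le : √(1 / 4 - δ ^ 2) ≤ 1 / 2 := by
    rw [Real.sqrt_le_left (by norm_num)]
    nlinarith
  have hγ_half : 1 / 2 < γ := by linarith
  have hγ0 : 0 < γ := by linarith
  have hfix : γ * γ + δ ^ 2 = γ := by rw [hγ]; linear_combination hsq
  have hθ0 : 0 < θ := hθ ▸ div_pos hδ0 hγ0
  have hθ1 : θ < 1 := by rw [hθ, div_lt_one hγ0]; linarith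
  have hθγ : θ * γ = δ := by rw [hθ]; field_simp
  have hgrow : ∀ n, γ * |b (n + 1)| * |d n| ≤ |d (n + 1)| :=
    mul_abs_le_abs_succ hδ0.le hγ0 (by linarith) hfix ha hc hd0 hd1 hd
  have hb_pos : ∀ n, 0 < |b (n + 1)| := fun n => abs_pos.2 (hb _ (by omega))
  have hd_ne : ∀ n, d n ≠ 0 := by
    intro n
    induction n with
    | zero => simp [hd0]
    | succ n ih =>
      have := hb_pos n
      have : 0 < |d n| := abs_pos.2 ih
      exact abs_pos.1 ((hgrow n).trans_lt' (by positivity))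
  have hcd : ∀ n, |c (n + 1)| * |d n| ≤ θ * |d (n + 1)| := fun n =>
    calc |c (n + 1)| * |d n| ≤ δ * |b (n + 1)| * |d n| := by
          gcongr
          exact hc _ (by omega)
      _ = θ * (γ * |b (n + 1)| * |d n|) := by rw [← hθγ]; ring
      _ ≤ θ * |d (n + 1)| := by gcongr; exact hgrow n
  set Z := ⨆ j : ℕ, |z j| * ((m : ℝ) + j) ^ s
  have hm1 : (1 : ℝ) ≤ m := by exact_mod_cast hm
  have hmpos : ∀ j : ℕ, (0 : ℝ) < m + j := fun j => by positivity
  have hzZ : ∀ j, |z j| * ((m : ℝ) + j) ^ s ≤ Z := fun j => le_ciSup hz j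
  have hZ : 0 ≤ Z := (hzZ 0).trans' (by positivity)
  have hterm : ∀ k l, |Uterm c d z k l| ≤
      1 / (γ * (C₁ * ((m : ℝ) + k) ^ sL)) * (Z / ((m : ℝ) + k) ^ s) * θ ^ l := by
    intro k l
    have hk := hmpos k
    have hkl : (m : ℝ) + k ≤ m + (k + l : ℕ) := by push_cast; linarith [l.cast_nonneg (α := ℝ)]
    refine abs_Uterm_le hθ0.le hcd hd_ne (by positivity) k l ?_ ?_
    · rw [div_le_div_iff₀ (abs_pos.2 (hd_ne _)) (by positivity), one_mul]
      calc |d (k + l)| * (γ * (C₁ * ((m : ℝ) + k) ^ sL))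
          ≤ |d (k + l)| * (γ * (C₁ * ((m : ℝ) + (k + l : ℕ)) ^ sL)) := by gcongr
        _ ≤ |d (k + l)| * (γ * |b (k + l + 1)|) := by gcongr; exact hblow _
        _ = γ * |b (k + l + 1)| * |d (k + l)| := by ring
        _ ≤ |d (k + l + 1)| := hgrow _
    · rw [le_div_iff₀ (by positivity)]
      refine (hzZ (k + l)).trans' ?_
      gcongr
  have hmain := fun k => summable_and_abs_Uinv_le hθ0.le hθ1 (hterm k)
  have hθ' : 0 < 1 - θ := by linarith
  refine ⟨fun k => ⟨(hmain k).1, (hmain k).2.trans ?_⟩, Z / (γ * C₁ * (1 - θ)), ?_⟩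
  · have hk := hmpos k
    calc 1 / (γ * (C₁ * ((m : ℝ) + k) ^ sL)) * (Z / ((m : ℝ) + k) ^ s) / (1 - θ)
        = Z / (C₁ * γ * (1 - θ) * ((m : ℝ) + k) ^ sL * ((m : ℝ) + k) ^ s) := by field_simp
      _ ≤ Z / (C₁ * γ * (1 - θ) * ((k : ℝ) + 1) ^ sL * ((m : ℝ) + k) ^ s) := by
        gcongr Z / (_ * ?_ ^ sL * _)
        linarith
  · rintro _ ⟨k, rfl⟩
    have hk := hmpos k
    calc |Uinv c d z k| * ((m : ℝ) + k) ^ (s + sL)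
        ≤ 1 / (γ * (C₁ * ((m : ℝ) + k) ^ sL)) * (Z / ((m : ℝ) + k) ^ s) / (1 - θ) *
            ((m : ℝ) + k) ^ (s + sL) := by gcongr; exact (hmain k).2
      _ = Z / (γ * C₁ * (1 - θ)) := by rw [Real.rpow_add hk]; field_simp
end

section
/- Let e₀ denote the sequence (1, 0, 0, …) and let w := G e₀. Then all the series occurring in the definition of w converge absolutely and for every k ≥ 0, |w_k| ≤ η θ^k / |b_1|. -/
/-- The sequence `e₀ = (1, 0, 0, …)`. -/
def e₀ : ℕ → ℝ := fun k => if k = 0 then 1 else 0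

/-- The determinants grow at least geometrically, at the rate `γ` relative to the diagonal. -/
theorem growth_of_recurrence {δ γ : ℝ} (hγ : 0 < γ) (hγ1 : γ ≤ 1) (hγδ : γ ^ 2 + δ ^ 2 = γ)
    {a b c d : ℕ → ℝ}
    (ha : ∀ n, 2 ≤ n → |a n| ≤ δ * |b n|) (hc : ∀ n, 1 ≤ n → |c n| ≤ δ * |b n|)
    (hd0 : d 0 = 1) (hd1 : d 1 = b 1)
    (hd : ∀ n : ℕ, d (n + 2) = b (n + 2) * d (n + 1) - a (n + 2) * c (n + 1) * d n) (k : ℕ) :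
    γ * |b (k + 1)| * |d k| ≤ |d (k + 1)| := by
  induction k with
  | zero =>
    simp only [zero_add, hd0, hd1, abs_one, mul_one]
    nlinarith [abs_nonneg (b 1)]
  | succ n ih =>
    have hac : |a (n + 2)| * |c (n + 1)| ≤ (δ * |b (n + 2)|) * (δ * |b (n + 1)|) :=
      mul_le_mul (ha _ (by omega)) (hc _ (by omega)) (abs_nonneg _)
        ((abs_nonneg _).trans (ha _ (by omega)))
    have htri : |b (n + 2)| * |d (n + 1)| - |a (n + 2)| * |c (n + 1)| * |d n| ≤ |d (n + 2)| := by
      rw [hd, ← abs_mul, ← abs_mul, ← abs_mul]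
      exact abs_sub_abs_le_abs_sub _ _
    have h1 := mul_le_mul_of_nonneg_right hac (abs_nonneg (d n))
    have h2 := mul_le_mul_of_nonneg_left ih (mul_nonneg (sq_nonneg δ) (abs_nonneg (b (n + 2))))
    have h3 : γ * (γ * |b (n + 2)| * |d (n + 1)|) ≤ γ * |d (n + 2)| := by
      have h4 : γ * (|b (n + 2)| * |d (n + 1)|) =
          γ ^ 2 * (|b (n + 2)| * |d (n + 1)|) + δ ^ 2 * (|b (n + 2)| * |d (n + 1)|) := by
        rw [← add_mul, hγδ]
      have h5 := mul_le_mul_of_nonneg_left htri hγ.le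
      have h6 := mul_le_mul_of_nonneg_left h1 hγ.le
      linarith
    exact le_of_mul_le_mul_left h3 hγ

/-- Products of superdiagonal entries are controlled by quotients of the determinants. -/
theorem abs_mul_abs_prod_le_of_growth {δ γ : ℝ} (hδ : 0 ≤ δ) (hγ : 0 < γ) {b c d : ℕ → ℝ}
    (hc : ∀ n, 1 ≤ n → |c n| ≤ δ * |b n|)
    (hg : ∀ k, γ * |b (k + 1)| * |d k| ≤ |d (k + 1)|) (k l : ℕ) :
    |d k| * |∏ i ∈ Finset.range l, c (k + 1 + i)| ≤ (δ / γ) ^ l * |d (k + l)| := by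
  induction l with
  | zero => simp
  | succ l ih =>
    have hcl := hc (k + l + 1) (by omega)
    rw [Finset.prod_range_succ, abs_mul, ← mul_assoc, show k + 1 + l = k + l + 1 by ring]
    calc _ ≤ (δ / γ) ^ l * |d (k + l)| * (δ * |b (k + l + 1)|) := by gcongr
      _ = (δ / γ) ^ (l + 1) * (γ * |b (k + l + 1)| * |d (k + l)|) := by
        rw [pow_succ]; field_simp
      _ ≤ _ := by gcongr; exact hg (k + l)

/-- Products of subdiagonal entries are controlled by the determinants. -/
theorem abs_prod_mul_abs_le_of_growth {δ γ : ℝ} (hδ : 0 ≤ δ) (hγ : 0 < γ) {a b d : ℕ → ℝ}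
    (ha : ∀ n, 2 ≤ n → |a n| ≤ δ * |b n|) (hd0 : d 0 = 1)
    (hg : ∀ k, γ * |b (k + 1)| * |d k| ≤ |d (k + 1)|) (k : ℕ) :
    |∏ i ∈ Finset.range k, a (i + 2)| * |b 1| ≤ (δ / γ) ^ k * |b (k + 1)| * |d k| := by
  induction k with
  | zero => simp [hd0]
  | succ k ih =>
    have hak := ha (k + 2) (by omega)
    rw [Finset.prod_range_succ, abs_mul, mul_right_comm]
    calc _ ≤ (δ / γ) ^ k * |b (k + 1)| * |d k| * (δ * |b (k + 2)|) := by gcongr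
      _ = (δ / γ) ^ (k + 1) * |b (k + 2)| * (γ * |b (k + 1)| * |d k|) := by
        rw [pow_succ]; field_simp
      _ ≤ _ := by gcongr; exact hg k

/-- The forward substitution applied to `e₀` is a single product. -/
theorem forward_substitution_e₀ {a d z : ℕ → ℝ} (hd0 : d 0 = 1) (hz0 : z 0 = e₀ 0)
    (hzk : ∀ k, 1 ≤ k → z k = e₀ k + ∑ l ∈ Finset.Icc 1 k,
      (-1 : ℝ) ^ l * (∏ i ∈ Finset.range l, a (k + 1 - i)) * (d (k - l) / d k) * e₀ (k - l))
    (k : ℕ) : z k = (-1) ^ k * (∏ i ∈ Finset.range k, a (i + 2)) / d k := by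
  rcases Nat.eq_zero_or_pos k with rfl | hk
  · simp [hz0, e₀, hd0]
  · rw [hzk k hk, Finset.sum_eq_single_of_mem k (Finset.mem_Icc.2 ⟨hk, le_rfl⟩)]
    · rw [← Finset.prod_range_reflect (fun i => a (i + 2))]
      have hprod : ∏ i ∈ Finset.range k, a (k + 1 - i) =
          ∏ i ∈ Finset.range k, a (k - 1 - i + 2) := by
        refine Finset.prod_congr rfl fun i hi => ?_
        rw [Finset.mem_range] at hi
        congr 1
        omega
      simp [e₀, hk.ne', hd0, hprod, div_eq_mul_inv]
    · intro l hl hlk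
      rw [Finset.mem_Icc] at hl
      simp [e₀, show k - l ≠ 0 by omega]

/-- Geometric decay in both indices of the terms of the back substitution. -/
theorem abs_Uterm_le_s8 {δ γ : ℝ} (hδ : 0 ≤ δ) (hγ : 0 < γ) {b c d z : ℕ → ℝ}
    (hb : ∀ n, 1 ≤ n → b n ≠ 0) (hc : ∀ n, 1 ≤ n → |c n| ≤ δ * |b n|)
    (hdne : ∀ k, d k ≠ 0)
    (hg : ∀ k, γ * |b (k + 1)| * |d k| ≤ |d (k + 1)|)
    (hz : ∀ k, |z k| ≤ (δ / γ) ^ k * |b (k + 1)| / |b 1|) (k l : ℕ) :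
    |Uterm c d z k l| ≤ (δ / γ) ^ k / (γ * |b 1|) * ((δ / γ) ^ 2) ^ l := by
  have hb1 : 0 < |b 1| := abs_pos.2 (hb 1 le_rfl)
  have hbl : 0 < |b (k + l + 1)| := abs_pos.2 (hb _ (by omega))
  have hdl : 0 < |d (k + l)| := abs_pos.2 (hdne _)
  have hdl1 : 0 < |d (k + l + 1)| := abs_pos.2 (hdne _)
  calc |Uterm c d z k l|
      = |d k| * |∏ i ∈ Finset.range l, c (k + 1 + i)| / |d (k + l + 1)| * |z (k + l)| := by
        simp only [Uterm, abs_mul, abs_div, abs_pow, abs_neg, abs_one, one_pow, one_mul]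
        ring
    _ ≤ (δ / γ) ^ l * |d (k + l)| / (γ * |b (k + l + 1)| * |d (k + l)|) *
          ((δ / γ) ^ (k + l) * |b (k + l + 1)| / |b 1|) := by
        refine mul_le_mul (div_le_div₀ (by positivity) ?_ (by positivity) (hg (k + l)))
          (hz (k + l)) (abs_nonneg _) (by positivity)
        exact abs_mul_abs_prod_le_of_growth hδ hγ hc hg k l
    _ = _ := by
        generalize δ / γ = θ
        field_simp
        ring

/-- for `w := G e₀ = U⁻¹(L⁻¹ e₀)`, all the series occurring in the
definition of `w` converge absolutely and `|w_k| ≤ η θ^k / |b_1|` for every `k ≥ 0`. -/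
theorem statement8 (δ : ℝ) (hδ0 : 0 < δ) (hδ1 : δ < 1 / 2)
    (a b c : ℕ → ℝ)
    (hb : ∀ n, 1 ≤ n → b n ≠ 0)
    (ha : ∀ n, 2 ≤ n → |a n| ≤ δ * |b n|)
    (hc : ∀ n, 1 ≤ n → |c n| ≤ δ * |b n|)
    (d : ℕ → ℝ)
    (hd0 : d 0 = 1) (hd1 : d 1 = b 1)
    (hd : ∀ n : ℕ, d (n + 2) = b (n + 2) * d (n + 1) - a (n + 2) * c (n + 1) * d n)
    (γ θ η : ℝ) (hγ : γ = 1 / 2 + Real.sqrt (1 / 4 - δ ^ 2)) (hθ : θ = δ / γ)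
    (hη : η = 1 / (γ * (1 - θ ^ 2)))
    (z : ℕ → ℝ)
    (hz0 : z 0 = e₀ 0)
    (hzk : ∀ k, 1 ≤ k → z k = e₀ k + ∑ l ∈ Finset.Icc 1 k,
      (-1 : ℝ) ^ l * (∏ i ∈ Finset.range l, a (k + 1 - i)) * (d (k - l) / d k) * e₀ (k - l)) :
    ∀ k : ℕ, Summable (fun l : ℕ => |Uterm c d z k (l + 1)|) ∧
      |Uinv c d z k| ≤ η * θ ^ k / |b 1| := by
  have hs := Real.sqrt_nonneg (1 / 4 - δ ^ 2)
  have hss := Real.sq_sqrt (show (0 : ℝ) ≤ 1 / 4 - δ ^ 2 by nlinarith)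
  have hγ0 : 0 < γ := by linarith
  have hγδ : γ ^ 2 + δ ^ 2 = γ := by rw [hγ]; nlinarith
  have hγ1 : γ ≤ 1 := by nlinarith [sq_nonneg δ]
  have hθ0 : 0 ≤ θ := by rw [hθ]; positivity
  have hθ1 : θ < 1 := by rw [hθ, div_lt_one hγ0]; linarith
  have hg := growth_of_recurrence hγ0 hγ1 hγδ ha hc hd0 hd1 hd
  have hdne : ∀ k, d k ≠ 0 := by
    intro k
    induction k with
    | zero => simp [hd0]
    | succ k ih =>
      have hbk := abs_pos.2 (hb (k + 1) (by omega))
      have hdk := abs_pos.2 ih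
      exact abs_pos.1 (lt_of_lt_of_le (by positivity) (hg k))
  have hz : ∀ k, |z k| ≤ (δ / γ) ^ k * |b (k + 1)| / |b 1| := by
    intro k
    rw [forward_substitution_e₀ hd0 hz0 hzk k, abs_div, abs_mul, abs_pow, abs_neg, abs_one,
      one_pow, one_mul, div_le_div_iff₀ (abs_pos.2 (hdne k)) (abs_pos.2 (hb 1 le_rfl))]
    exact abs_prod_mul_abs_le_of_growth hδ0.le hγ0 ha hd0 hg k
  intro k
  have hterm := abs_Uterm_le_s8 hδ0.le hγ0 hb hc hdne hg hz k
  rw [← hθ] at hterm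
  have hgeom := (hasSum_geometric_of_lt_one (sq_nonneg θ) (by nlinarith : θ ^ 2 < 1)).mul_left
    (θ ^ k / (γ * |b 1|))
  have hsum : Summable fun l => |Uterm c d z k l| :=
    Summable.of_nonneg_of_le (fun _ => abs_nonneg _) hterm hgeom.summable
  refine ⟨(summable_nat_add_iff 1).2 hsum, ?_⟩
  have hU : Uinv c d z k = ∑' l, Uterm c d z k l := by
    rw [hsum.of_abs.tsum_eq_zero_add]
    simp [Uinv, Uterm]
  rw [hU]
  calc |∑' l, Uterm c d z k l| ≤ θ ^ k / (γ * |b 1|) * (1 - θ ^ 2)⁻¹ :=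
        tsum_of_norm_bounded (f := Uterm c d z k) hgeom hterm
    _ = η * θ ^ k / |b 1| := by
        rw [hη]
        simp only [div_eq_mul_inv, mul_inv]
        ring
end

section
/- Let s > 1 and suppose Y_s := sup_{k≥0} |y_k| (m+k)^s < ∞. Then for every k ≥ 0, |(G y)_k| (m+k)^{s+s_L} ≤ (η Y_s / C₁) ( Σ_{l=0}^{k} θ^{k−l} ((m+k)/(m+l))^{s+s_L} + θ/(1−θ) ). -/
/-- Under diagonal dominance, consecutive determinants of the leading minors grow at least like
`γ |b|`. -/
lemma continuant_growth {δ γ : ℝ} (hδ : 0 < δ) (hγ : 0 < γ) (hγδ : γ * γ + δ ^ 2 = γ)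
    {a b c d : ℕ → ℝ} (hb : ∀ n, 1 ≤ n → b n ≠ 0)
    (ha : ∀ n, 2 ≤ n → |a n| ≤ δ * |b n|) (hc : ∀ n, 1 ≤ n → |c n| ≤ δ * |b n|)
    (hd0 : d 0 = 1) (hd1 : d 1 = b 1)
    (hd : ∀ n : ℕ, d (n + 2) = b (n + 2) * d (n + 1) - a (n + 2) * c (n + 1) * d n) (n : ℕ) :
    0 < |d n| ∧ γ * |b (n + 1)| * |d n| ≤ |d (n + 1)| := by
  induction n with
  | zero =>
    have h1 : γ ≤ 1 := by nlinarith [sq_nonneg δ]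
    simp only [hd0, hd1, abs_one, zero_add, mul_one]
    exact ⟨one_pos, mul_le_of_le_one_left (abs_nonneg _) h1⟩
  | succ n ih =>
    obtain ⟨hdn, hg⟩ := ih
    have hb1 : 0 < |b (n + 1)| := abs_pos.2 (hb _ (by omega))
    refine ⟨(by positivity : 0 < γ * |b (n + 1)| * |d n|).trans_le hg, ?_⟩
    have hac : |a (n + 2)| * |c (n + 1)| ≤ (δ * |b (n + 2)|) * (δ * |b (n + 1)|) :=
      mul_le_mul (ha _ (by omega)) (hc _ (by omega)) (abs_nonneg _) (by positivity)
    have htri : |b (n + 2)| * |d (n + 1)| - |a (n + 2)| * |c (n + 1)| * |d n| ≤ |d (n + 2)| := by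
      rw [hd n, ← abs_mul, ← abs_mul, ← abs_mul]
      exact abs_sub_abs_le_abs_sub _ _
    have h1 : |a (n + 2)| * |c (n + 1)| * |d n| ≤
        δ ^ 2 * |b (n + 2)| * (|b (n + 1)| * |d n|) := by
      calc _ ≤ (δ * |b (n + 2)|) * (δ * |b (n + 1)|) * |d n| := by gcongr
        _ = _ := by ring
    have h2 : δ ^ 2 * |b (n + 2)| * (γ * |b (n + 1)| * |d n|) ≤
        δ ^ 2 * |b (n + 2)| * |d (n + 1)| := by gcongr
    have h3 : γ * (γ * |b (n + 2)| * |d (n + 1)|) ≤ γ * |d (n + 2)| := by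
      have e : γ * (γ * |b (n + 2)| * |d (n + 1)|) =
          γ * (|b (n + 2)| * |d (n + 1)|) - δ ^ 2 * |b (n + 2)| * |d (n + 1)| := by
        linear_combination (|b (n + 2)| * |d (n + 1)|) * hγδ
      have h4 := mul_le_mul_of_nonneg_left h1 hγ.le
      have h5 := mul_le_mul_of_nonneg_left htri hγ.le
      linarith
    exact le_of_mul_le_mul_left h3 hγ

/-- Entries of the inverse of the upper bidiagonal factor decay geometrically off the diagonal. -/
lemma abs_upper_entry_le {δ γ : ℝ} (hδ : 0 < δ) (hγ : 0 < γ) {b c d : ℕ → ℝ}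
    (hb : ∀ n, 1 ≤ n → b n ≠ 0) (hc : ∀ n, 1 ≤ n → |c n| ≤ δ * |b n|)
    (hdn : ∀ n, 0 < |d n|) (hr : ∀ n, |d n| / |d (n + 1)| ≤ 1 / (γ * |b (n + 1)|)) (k l : ℕ) :
    |d k| / |d (k + l + 1)| * ∏ i ∈ Finset.range l, |c (k + 1 + i)| ≤
      (δ / γ) ^ l / (γ * |b (k + l + 1)|) := by
  induction l with
  | zero => simpa using hr k
  | succ l ih =>
    have hb1 : 0 < |b (k + l + 1)| := abs_pos.2 (hb _ (by omega))
    have hb2 : 0 < |b (k + l + 1 + 1)| := abs_pos.2 (hb _ (by omega))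
    have hc1 : |c (k + 1 + l)| ≤ δ * |b (k + l + 1)| := by
      rw [show k + 1 + l = k + l + 1 by omega]; exact hc _ (by omega)
    rw [Finset.prod_range_succ]
    calc |d k| / |d (k + (l + 1) + 1)| *
          ((∏ i ∈ Finset.range l, |c (k + 1 + i)|) * |c (k + 1 + l)|)
        = (|d k| / |d (k + l + 1)| * ∏ i ∈ Finset.range l, |c (k + 1 + i)|) *
          ((|d (k + l + 1)| / |d (k + l + 1 + 1)|) * |c (k + 1 + l)|) := by
          have := (hdn (k + l + 1)).ne'
          rw [show k + (l + 1) + 1 = k + l + 1 + 1 by omega]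
          field_simp
      _ ≤ ((δ / γ) ^ l / (γ * |b (k + l + 1)|)) *
          (1 / (γ * |b (k + l + 1 + 1)|) * (δ * |b (k + l + 1)|)) := by
          refine mul_le_mul ih (mul_le_mul (hr _) hc1 (abs_nonneg _) (by positivity)) ?_ ?_ <;>
            positivity
      _ = _ := by
          rw [show k + (l + 1) + 1 = k + l + 1 + 1 by omega, pow_succ]
          field_simp

/-- Entries of the inverse of the lower bidiagonal factor, rescaled by the diagonal, decay
geometrically off the diagonal. -/
lemma abs_lower_entry_le {δ γ : ℝ} (hδ : 0 < δ) (hγ : 0 < γ) {a b d : ℕ → ℝ}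
    (hb : ∀ n, 1 ≤ n → b n ≠ 0) (ha : ∀ n, 2 ≤ n → |a n| ≤ δ * |b n|)
    (hdn : ∀ n, 0 < |d n|) (hr : ∀ n, |d n| / |d (n + 1)| ≤ 1 / (γ * |b (n + 1)|))
    (k l : ℕ) (hl : l ≤ k) :
    (∏ i ∈ Finset.range l, |a (k + 1 - i)|) * (|d (k - l)| / |d k|) ≤
      (δ / γ) ^ l * |b (k + 1)| / |b (k - l + 1)| := by
  induction l with
  | zero =>
    have := (hdn k).ne'
    have hb1 : |b (k + 1)| ≠ 0 := (abs_pos.2 (hb _ (by omega))).ne'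
    simp [*]
  | succ l ih =>
    have ih := ih (by omega)
    obtain ⟨j, rfl⟩ : ∃ j, k = j + l + 1 := ⟨k - l - 1, by omega⟩
    rw [show j + l + 1 - l = j + 1 by omega] at ih
    rw [Finset.prod_range_succ, show j + l + 1 - (l + 1) = j by omega,
      show j + l + 1 + 1 - l = j + 2 by omega]
    have hb0 : 0 < |b (j + 1)| := abs_pos.2 (hb _ (by omega))
    have hb1 : 0 < |b (j + 1 + 1)| := abs_pos.2 (hb _ (by omega))
    have ha1 : |a (j + 2)| ≤ δ * |b (j + 1 + 1)| := ha _ (by omega)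
    calc (∏ i ∈ Finset.range l, |a (j + l + 1 + 1 - i)|) * |a (j + 2)| *
          (|d j| / |d (j + l + 1)|)
        = ((∏ i ∈ Finset.range l, |a (j + l + 1 + 1 - i)|) * (|d (j + 1)| / |d (j + l + 1)|)) *
          ((|d j| / |d (j + 1)|) * |a (j + 2)|) := by
          have := (hdn (j + 1)).ne'
          field_simp
      _ ≤ ((δ / γ) ^ l * |b (j + l + 1 + 1)| / |b (j + 1 + 1)|) *
          (1 / (γ * |b (j + 1)|) * (δ * |b (j + 1 + 1)|)) := by
          refine mul_le_mul ih (mul_le_mul (hr _) ha1 (abs_nonneg _) (by positivity)) ?_ ?_ <;>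
            positivity
      _ = _ := by rw [pow_succ]; field_simp

/-- A geometric convolution of an antitone sequence, evaluated `l` steps ahead. -/
lemma geom_conv_add_le {θ : ℝ} (hθ0 : 0 ≤ θ) (hθ1 : θ < 1) {W : ℕ → ℝ} (hW : Antitone W)
    (k l : ℕ) :
    ∑ j ∈ Finset.range (k + l + 1), θ ^ (k + l - j) * W j ≤
      θ ^ l * ∑ j ∈ Finset.range (k + 1), θ ^ (k - j) * W j +
        W k * ((1 - θ ^ l) / (1 - θ)) := by
  have h1 : 1 - θ ≠ 0 := by linarith
  induction l with
  | zero => simp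
  | succ l ih =>
    rw [show k + (l + 1) + 1 = (k + l + 1) + 1 by omega, Finset.sum_range_succ]
    have e : ∑ j ∈ Finset.range (k + l + 1), θ ^ (k + (l + 1) - j) * W j =
        θ * ∑ j ∈ Finset.range (k + l + 1), θ ^ (k + l - j) * W j := by
      rw [Finset.mul_sum]
      refine Finset.sum_congr rfl fun j hj => ?_
      rw [Finset.mem_range] at hj
      rw [show k + (l + 1) - j = (k + l - j) + 1 by omega]
      ring
    have hWk : W (k + l + 1) ≤ W k := hW (by omega)
    have h2 := mul_le_mul_of_nonneg_left ih hθ0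
    have e2 : (1 - θ ^ (l + 1)) / (1 - θ) = θ * ((1 - θ ^ l) / (1 - θ)) + 1 := by
      field_simp; ring
    rw [e, e2, show k + (l + 1) - (k + l + 1) = 0 by omega, pow_succ]
    linarith

lemma hasSum_geom_conv {θ : ℝ} (hθ0 : 0 ≤ θ) (hθ1 : θ < 1) (V w : ℝ) :
    HasSum (fun l : ℕ => θ ^ l * (θ ^ l * V + w * ((1 - θ ^ l) / (1 - θ))))
      (1 / (1 - θ ^ 2) * (V + w * (θ / (1 - θ)))) := by
  have h1 : 1 - θ ≠ 0 := by linarith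
  have hA := hasSum_geometric_of_lt_one hθ0 hθ1
  have hB := hasSum_geometric_of_lt_one (sq_nonneg θ) (by nlinarith : θ ^ 2 < 1)
  have hS : 1 / (1 - θ ^ 2) * (V + w * (θ / (1 - θ))) =
      (1 - θ ^ 2)⁻¹ * V + ((1 - θ)⁻¹ - (1 - θ ^ 2)⁻¹) * (w / (1 - θ)) := by
    have h3 : (1 - θ)⁻¹ = (1 + θ) * (1 - θ ^ 2)⁻¹ := by
      rw [show 1 - θ ^ 2 = (1 + θ) * (1 - θ) by ring]
      have : 1 + θ ≠ 0 := by linarith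
      field_simp
    rw [h3]
    ring
  have hf : (fun l : ℕ => θ ^ l * (θ ^ l * V + w * ((1 - θ ^ l) / (1 - θ)))) =
      fun l => (θ ^ 2) ^ l * V + (θ ^ l - (θ ^ 2) ^ l) * (w / (1 - θ)) := by
    funext l
    rw [← pow_mul, mul_comm 2 l, pow_mul]
    ring
  rw [hS, hf]
  exact (hB.mul_right V).add ((hA.sub hB).mul_right (w / (1 - θ)))

lemma abs_Uinv_le {c d z : ℕ → ℝ} {k : ℕ} {g : ℕ → ℝ} {S : ℝ} (hg : HasSum g S)
    (h : ∀ l, |Uterm c d z k l| ≤ g l) : |Uinv c d z k| ≤ S := by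
  have h0 : d k / d (k + 1) * z k = Uterm c d z k 0 := by simp [Uterm]
  have hs : HasSum (fun l => g (l + 1)) (S - g 0) := by
    simpa using (hasSum_nat_add_iff' 1).2 hg
  have ht : |∑' l : ℕ, Uterm c d z k (l + 1)| ≤ S - g 0 := by
    rw [← Real.norm_eq_abs]
    exact tsum_of_norm_bounded hs fun l => h (l + 1)
  rw [Uinv, h0]
  linarith [abs_add_le (Uterm c d z k 0) (∑' l : ℕ, Uterm c d z k (l + 1)), h 0]

/-- if `Y_s := sup_{k≥0} |y_k| (m+k)^s < ∞` (`s > 1`), then for every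
`k ≥ 0`, `|(G y)_k| (m+k)^{s+s_L} ≤ (η Y_s / C₁) (Σ_{l=0}^{k} θ^{k−l}
((m+k)/(m+l))^{s+s_L} + θ/(1−θ))`, where `G y = U⁻¹(L⁻¹ y)`. -/
theorem statement10 (δ : ℝ) (hδ0 : 0 < δ) (hδ1 : δ < 1 / 2)
    (a b c : ℕ → ℝ)
    (hb : ∀ n, 1 ≤ n → b n ≠ 0)
    (ha : ∀ n, 2 ≤ n → |a n| ≤ δ * |b n|)
    (hc : ∀ n, 1 ≤ n → |c n| ≤ δ * |b n|)
    (d : ℕ → ℝ)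
    (hd0 : d 0 = 1) (hd1 : d 1 = b 1)
    (hd : ∀ n : ℕ, d (n + 2) = b (n + 2) * d (n + 1) - a (n + 2) * c (n + 1) * d n)
    (γ θ η : ℝ) (hγ : γ = 1 / 2 + Real.sqrt (1 / 4 - δ ^ 2)) (hθ : θ = δ / γ)
    (hη : η = 1 / (γ * (1 - θ ^ 2)))
    (m : ℕ) (hm : 1 ≤ m) (sL C₁ : ℝ) (hsL : 0 < sL) (hC₁ : 0 < C₁)
    (hblow : ∀ k : ℕ, C₁ * ((m : ℝ) + k) ^ sL ≤ |b (k + 1)|)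
    (y z : ℕ → ℝ)
    (hz0 : z 0 = y 0)
    (hzk : ∀ k, 1 ≤ k → z k = y k + ∑ l ∈ Finset.Icc 1 k,
      (-1 : ℝ) ^ l * (∏ i ∈ Finset.range l, a (k + 1 - i)) * (d (k - l) / d k) * y (k - l))
    (s : ℝ) (hs : 1 < s)
    (hy : BddAbove (Set.range fun k => |y k| * ((m : ℝ) + k) ^ s)) :
    ∀ k : ℕ, |Uinv c d z k| * ((m : ℝ) + k) ^ (s + sL) ≤
      η * (⨆ j : ℕ, |y j| * ((m : ℝ) + j) ^ s) / C₁ *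
        ((∑ l ∈ Finset.range (k + 1),
          θ ^ (k - l) * (((m : ℝ) + k) / ((m : ℝ) + l)) ^ (s + sL)) + θ / (1 - θ)) := by
  intro k
  have hsq : 0 < 1 / 4 - δ ^ 2 := by nlinarith
  have hrt := Real.sq_sqrt hsq.le
  have hrt0 : 0 < Real.sqrt (1 / 4 - δ ^ 2) := Real.sqrt_pos.2 hsq
  have hγ0 : 0 < γ := by rw [hγ]; linarith
  have hγδ : γ * γ + δ ^ 2 = γ := by rw [hγ]; nlinarith
  have hθ0 : 0 < θ := by rw [hθ]; positivity
  have hθ1 : θ < 1 := by rw [hθ, div_lt_one hγ0, hγ]; linarith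
  have hgr := continuant_growth hδ0 hγ0 hγδ hb ha hc hd0 hd1 hd
  have hdn : ∀ n, 0 < |d n| := fun n => (hgr n).1
  have hbp : ∀ n, 0 < |b (n + 1)| := fun n => abs_pos.2 (hb _ (by omega))
  have hr : ∀ n, |d n| / |d (n + 1)| ≤ 1 / (γ * |b (n + 1)|) := by
    intro n
    have := hbp n
    rw [div_le_div_iff₀ (hdn _) (by positivity)]
    linarith [(hgr n).2]
  have hm0 : ∀ j : ℕ, 0 < (m : ℝ) + j := fun j => by
    have : (1 : ℝ) ≤ m := by exact_mod_cast hm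
    positivity
  set Y := ⨆ j : ℕ, |y j| * ((m : ℝ) + j) ^ s with hY
  have hYj : ∀ j : ℕ, |y j| * ((m : ℝ) + j) ^ s ≤ Y := fun j => le_ciSup hy j
  have hY0 : 0 ≤ Y := le_trans (mul_nonneg (abs_nonneg _) (Real.rpow_nonneg (hm0 0).le _)) (hYj 0)
  set W : ℕ → ℝ := fun j => Y / C₁ / ((m : ℝ) + j) ^ (s + sL) with hW
  have hWanti : Antitone W := by
    intro i j hij
    have : (0 : ℝ) < ((m : ℝ) + i) ^ (s + sL) := Real.rpow_pos_of_pos (hm0 i) _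
    have hij' : (i : ℝ) ≤ j := by exact_mod_cast hij
    have := hm0 i
    simp only [hW]
    gcongr
  have hw : ∀ j : ℕ, |y j| / |b (j + 1)| ≤ W j := by
    intro j
    have h1 : 0 < ((m : ℝ) + j) ^ s := Real.rpow_pos_of_pos (hm0 j) _
    have h2 : 0 < ((m : ℝ) + j) ^ sL := Real.rpow_pos_of_pos (hm0 j) _
    simp only [hW]
    rw [Real.rpow_add (hm0 j), div_div, div_le_div_iff₀ (hbp j) (by positivity)]
    calc |y j| * (C₁ * (((m : ℝ) + j) ^ s * ((m : ℝ) + j) ^ sL))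
        = (|y j| * ((m : ℝ) + j) ^ s) * (C₁ * ((m : ℝ) + j) ^ sL) := by ring
      _ ≤ Y * |b (j + 1)| := mul_le_mul (hYj j) (hblow j) (by positivity) hY0
  have hz : ∀ n, |z n| / |b (n + 1)| ≤ ∑ j ∈ Finset.range (n + 1), θ ^ (n - j) * W j := by
    intro n
    have hzn : z n = ∑ l ∈ Finset.range (n + 1),
        (-1 : ℝ) ^ l * (∏ i ∈ Finset.range l, a (n + 1 - i)) * (d (n - l) / d n) * y (n - l) := by
      rcases Nat.eq_zero_or_pos n with rfl | hn
      · simp [hz0, hd0]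
      · have hdne : d n ≠ 0 := abs_pos.1 (hdn n)
        rw [hzk n hn, Finset.range_eq_Ico, Finset.sum_eq_sum_Ico_succ_bot (by omega)]
        simp only [pow_zero, Finset.range_zero, Finset.prod_empty, Nat.sub_zero, div_self hdne,
          one_mul, zero_add]
        rfl
    rw [← Finset.sum_flip (fun j => θ ^ (n - j) * W j), hzn, div_le_iff₀ (hbp n), Finset.sum_mul]
    refine (Finset.abs_sum_le_sum_abs _ _).trans (Finset.sum_le_sum fun l hl => ?_)
    rw [Finset.mem_range] at hl
    have hlow := abs_lower_entry_le hδ0 hγ0 hb ha hdn hr n l (by omega)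
    rw [← hθ] at hlow
    rw [show n - (n - l) = l by omega]
    simp only [abs_mul, abs_pow, abs_neg, abs_one, one_pow, one_mul, abs_div, Finset.abs_prod]
    calc _ ≤ θ ^ l * |b (n + 1)| / |b (n - l + 1)| * |y (n - l)| := by gcongr
      _ = θ ^ l * (|y (n - l)| / |b (n - l + 1)|) * |b (n + 1)| := by ring
      _ ≤ _ := by gcongr; exact hw _
  set V := ∑ j ∈ Finset.range (k + 1), θ ^ (k - j) * W j with hV
  have hU : ∀ l, |Uterm c d z k l| ≤
      γ⁻¹ * (θ ^ l * (θ ^ l * V + W k * ((1 - θ ^ l) / (1 - θ)))) := by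
    intro l
    have hup := abs_upper_entry_le hδ0 hγ0 hb hc hdn hr k l
    rw [← hθ] at hup
    simp only [Uterm, abs_mul, abs_pow, abs_neg, abs_one, one_pow, one_mul, abs_div,
      Finset.abs_prod]
    have hb' := hbp (k + l)
    calc _ ≤ θ ^ l / (γ * |b (k + l + 1)|) * |z (k + l)| := by gcongr
      _ = γ⁻¹ * (θ ^ l * (|z (k + l)| / |b (k + l + 1)|)) := by field_simp
      _ ≤ _ := by
        gcongr
        exact (hz (k + l)).trans (geom_conv_add_le hθ0.le hθ1 hWanti k l)
  have hmain := abs_Uinv_le ((hasSum_geom_conv hθ0.le hθ1 V (W k)).mul_left γ⁻¹) hU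
  have hp : 0 < ((m : ℝ) + k) ^ (s + sL) := Real.rpow_pos_of_pos (hm0 k) _
  refine (mul_le_mul_of_nonneg_right hmain hp.le).trans_eq ?_
  have hWk : W k * ((m : ℝ) + k) ^ (s + sL) = Y / C₁ := div_mul_cancel₀ _ hp.ne'
  have hVk : V * ((m : ℝ) + k) ^ (s + sL) = Y / C₁ * ∑ l ∈ Finset.range (k + 1),
      θ ^ (k - l) * (((m : ℝ) + k) / ((m : ℝ) + l)) ^ (s + sL) := by
    rw [hV, Finset.sum_mul, Finset.mul_sum]
    refine Finset.sum_congr rfl fun l _ => ?_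
    rw [Real.div_rpow (hm0 k).le (hm0 l).le]
    simp only [hW]
    ring
  have hηe : η = γ⁻¹ * (1 / (1 - θ ^ 2)) := by rw [hη]; simp [mul_comm]
  rw [hηe]
  linear_combination (γ⁻¹ * (1 / (1 - θ ^ 2))) * hVk +
    (γ⁻¹ * (1 / (1 - θ ^ 2)) * (θ / (1 - θ))) * hWk
end
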